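/- Let C ⊂ ℝ³ be a convex body and r₀ ∈ ∂C a ridge point whose tangent cone is the dihedral angle {r : (r − r₀, e₁) ≤ 0, (r − r₀, e₂) ≤ 0}, and let e = λ₁e₁ + λ₂e₂ with λ₁ > 0, λ₂ > 0, |e| = 1. Then every partial weak limit ν_* of the normalized surface measures ν_t as t → 0⁺ satisfies ∫_{S²} n dν_*(n) = e. -/

import Mathlib

open MeasureTheory Set Filter Topology
open scoped RealInnerProductSpace ENNReal

noncomputable section

attribute [local instance] Classical.propDecidable

abbrev E3 := EuclideanSpace ℝ (Fin 3)

/-- A convex body: a compact convex set with nonempty interior. -/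
def IsConvexBody (C : Set E3) : Prop :=
  IsCompact C ∧ Convex ℝ C ∧ (interior C).Nonempty

/-- The tangent cone to a convex set `C` at the point `r₀`: the closure of the set of
rays from `r₀` through points of `C`, translated to the origin. -/
def tanCone (C : Set E3) (r₀ : E3) : Set E3 :=
  closure {v : E3 | ∃ c : ℝ, ∃ r ∈ C, 0 ≤ c ∧ v = c • (r - r₀)}

/-- The dihedral angle `{v : ⟪v,e₁⟫ ≤ 0, ⟪v,e₂⟫ ≤ 0}` (as a cone of displacements). -/
def dihedral (e₁ e₂ : E3) : Set E3 := {v : E3 | ⟪v, e₁⟫ ≤ 0 ∧ ⟪v, e₂⟫ ≤ 0}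

/-- `n` is an outward unit normal of `C` at `r`. -/
def IsOutwardNormalAt (C : Set E3) (r n : E3) : Prop :=
  ‖n‖ = 1 ∧ ∀ x ∈ C, ⟪x - r, n⟫ ≤ 0

/-- `r` is a regular boundary point: the outward unit normal exists and is unique. -/
def IsRegularPt (C : Set E3) (r : E3) : Prop :=
  ∃! n : E3, IsOutwardNormalAt C r n

/-- The (Gauss) normal map of `C`, sending a boundary point to an outward unit normal
(the unique one at regular points), and junk value `0` elsewhere. -/
def normalMap (C : Set E3) (r : E3) : E3 :=
  if h : ∃ n : E3, IsOutwardNormalAt C r n then h.choose else 0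

/-- `B_t = C ∩ {r : ⟪r - r₀, e⟫ = -t}`. -/
def Bset (C : Set E3) (r₀ e : E3) (t : ℝ) : Set E3 :=
  C ∩ {r : E3 | ⟪r - r₀, e⟫ = -t}

/-- `S_t = ∂C ∩ {r : ⟪r - r₀, e⟫ ≥ -t}`. -/
def Sset (C : Set E3) (r₀ e : E3) (t : ℝ) : Set E3 :=
  frontier C ∩ {r : E3 | ⟪r - r₀, e⟫ ≥ -t}

/-- The normalized surface measure `ν_t` induced by `S_t`: the pushforward under the
normal map of the 2-dimensional Hausdorff measure restricted to the regular points of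
`S_t`, normalized by the area of `B_t`. -/
def nuT (C : Set E3) (r₀ e : E3) (t : ℝ) : Measure E3 :=
  (μH[2] (Bset C r₀ e t))⁻¹ •
    Measure.map (normalMap C) (μH[2].restrict (Sset C r₀ e t ∩ {r : E3 | IsRegularPt C r}))

/-- The arc `Γ = {μ₁e₁ + μ₂e₂ : |μ₁e₁ + μ₂e₂| = 1, μ₁ ≥ 0, μ₂ ≥ 0}`. -/
def arcGamma (e₁ e₂ : E3) : Set E3 :=
  {v : E3 | ∃ m₁ m₂ : ℝ, 0 ≤ m₁ ∧ 0 ≤ m₂ ∧ v = m₁ • e₁ + m₂ • e₂ ∧ ‖v‖ = 1}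

/-- Weak convergence of the family `ν t` to `ν₀` as `t → 0⁺`. -/
def WeaklyTendsto (ν : ℝ → Measure E3) (ν₀ : Measure E3) : Prop :=
  ∀ f : BoundedContinuousFunction E3 ℝ,
    Tendsto (fun t => ∫ x, f x ∂(ν t)) (𝓝[>] (0 : ℝ)) (𝓝 (∫ x, f x ∂ν₀))

/-- `ν₀` is a partial weak limit of the family `ν t` as `t → 0⁺`. -/
def IsPartialWeakLimit (ν : ℝ → Measure E3) (ν₀ : Measure E3) : Prop :=
  ∃ ts : ℕ → ℝ, (∀ i, 0 < ts i) ∧ Tendsto ts atTop (𝓝 (0 : ℝ)) ∧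
    ∀ f : BoundedContinuousFunction E3 ℝ,
      Tendsto (fun i => ∫ x, f x ∂(ν (ts i))) atTop (𝓝 (∫ x, f x ∂ν₀))

/-- The support of a measure: points all of whose open neighborhoods have positive measure. -/
def msupport (ν : Measure E3) : Set E3 :=
  {x : E3 | ∀ U : Set E3, IsOpen U → x ∈ U → 0 < ν U}

abbrev E2 := EuclideanSpace ℝ (Fin 2)

def proj (b : OrthonormalBasis (Fin 3) ℝ E3) : E3 →L[ℝ] E2 :=
  LinearMap.toContinuousLinearMap
    { toFun := fun x => !₂[⟪b 0, x⟫, ⟪b 1, x⟫]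
      map_add' := by intro x y; ext i; fin_cases i <;> simp [inner_add_right]
      map_smul' := by intro x y; ext i; fin_cases i <;> simp [inner_smul_right] }

lemma proj_apply (b : OrthonormalBasis (Fin 3) ℝ E3) (x : E3) :
    proj b x = !₂[⟪b 0, x⟫, ⟪b 1, x⟫] := rfl

lemma proj_norm_sq (b : OrthonormalBasis (Fin 3) ℝ E3) (x : E3) :
    ‖proj b x‖ ^ 2 = ‖x‖ ^ 2 - ⟪b 2, x⟫ ^ 2 := by
  have h := b.sum_sq_norm_inner_right x
  simp only [Fin.sum_univ_three, Real.norm_eq_abs, sq_abs] at h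
  rw [EuclideanSpace.norm_sq_eq, proj_apply]
  simp [Fin.sum_univ_two]
  linarith

lemma proj_norm_le (b : OrthonormalBasis (Fin 3) ℝ E3) (x : E3) : ‖proj b x‖ ≤ ‖x‖ := by
  have := proj_norm_sq b x
  refine le_of_sq_le_sq ?_ (norm_nonneg _)
  nlinarith [sq_nonneg ⟪b 2, x⟫]

/-- the linear map between coordinate planes -/
def planeMap (b c : OrthonormalBasis (Fin 3) ℝ E3) : E2 →ₗ[ℝ] E2 where
  toFun y := proj b (y 0 • c 0 + y 1 • c 1)
  map_add' := by
    intro x y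
    rw [← map_add]; congr 1
    simp only [PiLp.add_apply, add_smul]; abel
  map_smul' := by
    intro m y
    simp [mul_smul]

lemma proj_decomp (b c : OrthonormalBasis (Fin 3) ℝ E3) (x : E3) :
    proj b x = planeMap b c (proj c x) + ⟪c 2, x⟫ • proj b (c 2) := by
  have h := c.sum_repr' x
  rw [Fin.sum_univ_three] at h
  change _ = proj b (⟪c 0, x⟫ • c 0 + ⟪c 1, x⟫ • c 1) + _
  rw [← (proj b).map_smul, ← (proj b).map_add, h]

lemma planeMap_det (b c : OrthonormalBasis (Fin 3) ℝ E3) :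
    |LinearMap.det (planeMap b c)| = |⟪b 2, c 2⟫| := by
  rw [← sq_eq_sq_iff_abs_eq_abs]
  rw [← LinearMap.det_toMatrix (EuclideanSpace.basisFun (Fin 2) ℝ).toBasis, Matrix.det_fin_two]
  simp only [LinearMap.toMatrix_apply]
  simp [planeMap, proj_apply]
  have h00 := c.sum_inner_mul_inner (b 0) (b 0)
  have h11 := c.sum_inner_mul_inner (b 1) (b 1)
  have h01 := c.sum_inner_mul_inner (b 0) (b 1)
  have hc := b.sum_inner_mul_inner (c 2) (c 2)
  have e0 : ⟪b 0, b 0⟫ = 1 := by simp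
  have e1 : ⟪b 1, b 1⟫ = 1 := by simp
  have e01 : ⟪b 0, b 1⟫ = 0 := b.orthonormal.2 (by decide)
  have e2 : ⟪c 2, c 2⟫ = 1 := by simp
  simp only [Fin.sum_univ_three, e0, e1, e01, e2] at h00 h11 h01 hc
  simp only [real_inner_comm (b 0) (c _), real_inner_comm (b 1) (c _), real_inner_comm (b 2) (c _)] at *
  generalize ⟪b 0, c 0⟫ = a0 at *
  generalize ⟪b 0, c 1⟫ = a1 at *
  generalize ⟪b 0, c 2⟫ = a2 at *
  generalize ⟪b 1, c 0⟫ = d0 at *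
  generalize ⟪b 1, c 1⟫ = d1 at *
  generalize ⟪b 1, c 2⟫ = d2 at *
  generalize ⟪b 2, c 2⟫ = g2 at *
  have k1 : a0 * a0 + a1 * a1 = 1 - a2 * a2 := by linarith
  have k2 : d0 * d0 + d1 * d1 = 1 - d2 * d2 := by linarith
  have k3 : a0 * d0 + a1 * d1 = - (a2 * d2) := by linarith
  have : (a0 * d1 - a1 * d0) ^ 2 = (a0 * a0 + a1 * a1) * (d0 * d0 + d1 * d1) - (a0 * d0 + a1 * d1) ^ 2 := by ring
  rw [k1, k2, k3] at this
  linarith [show (1 - a2 * a2) * (1 - d2 * d2) - (-(a2 * d2)) ^ 2 = 1 - a2 * a2 - d2 * d2 by ring]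

lemma exists_onb (u : E3) (hu : ‖u‖ = 1) : ∃ b : OrthonormalBasis (Fin 3) ℝ E3, b 2 = u := by
  have : Orthonormal ℝ (({2} : Set (Fin 3)).domRestrict (fun _ => u)) := by
    rw [orthonormal_iff_ite]
    rintro ⟨i, rfl⟩ ⟨j, rfl⟩
    simp [hu]
  obtain ⟨b, hb⟩ := this.exists_orthonormalBasis_extension_of_card_eq (by simp)
  exact ⟨b, hb 2 rfl⟩

instance haarE2 : Measure.IsAddHaarMeasure (μH[2] : Measure E2) := by
  have := isAddHaarMeasure_hausdorffMeasure (E := E2)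
  simpa using this

/-- comparison of Hausdorff measures of two images -/
lemma hausdorff_compare {X Y Z : Type*} [MetricSpace Y] [MetricSpace Z]
    [MeasurableSpace Y] [BorelSpace Y] [MeasurableSpace Z] [BorelSpace Z]
    (f : X → Y) (g : X → Z) (A : Set X) (K : ℝ) (hK : 0 ≤ K) (d : ℝ) (hd : 0 ≤ d)
    (h : ∀ r ∈ A, ∀ s ∈ A, dist (f r) (f s) ≤ K * dist (g r) (g s)) :
    μH[d] (f '' A) ≤ ENNReal.ofReal K ^ d * μH[d] (g '' A) := by
  rcases A.eq_empty_or_nonempty with rfl | ⟨a, ha⟩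
  · simp
  have : Nonempty X := ⟨a⟩
  let F : Z → Y := fun z => f (Function.invFunOn g A z)
  have hinv : ∀ z ∈ g '' A, Function.invFunOn g A z ∈ A ∧ g (Function.invFunOn g A z) = z :=
    fun z hz => ⟨Function.invFunOn_mem hz, Function.invFunOn_eq hz⟩
  have hF : LipschitzOnWith K.toNNReal F (g '' A) := by
    apply LipschitzOnWith.of_dist_le_mul
    intro x hx y hy
    obtain ⟨h1, h2⟩ := hinv x hx
    obtain ⟨h3, h4⟩ := hinv y hy
    have := h _ h1 _ h3
    rw [h2, h4] at this
    simpa [F, Real.coe_toNNReal _ hK] using this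
  have himg : f '' A = F '' (g '' A) := by
    have key : ∀ r ∈ A, F (g r) = f r := by
      intro r hr
      obtain ⟨h1, h2⟩ := hinv (g r) ⟨r, hr, rfl⟩
      have := h _ h1 _ hr
      rw [h2, dist_self, mul_zero] at this
      exact dist_le_zero.1 this
    rw [image_image]
    exact (image_congr key).symm
  rw [himg]
  exact hF.hausdorffMeasure_image_le hd

lemma local_area (b c : OrthonormalBasis (Fin 3) ℝ E3) (hne : ⟪b 2, c 2⟫ ≠ 0) (K : ℝ) (hK : 1 < K) :
    ∃ ε > 0, ∀ A : Set E3, (∀ r ∈ A, ∀ s ∈ A, |⟪c 2, r - s⟫| ≤ ε * ‖r - s‖) →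
      μH[2] (proj b '' A) ≤ ENNReal.ofReal K * (ENNReal.ofReal |⟪b 2, c 2⟫| * μH[2] A) ∧
      ENNReal.ofReal |⟪b 2, c 2⟫| * μH[2] A ≤ ENNReal.ofReal K * μH[2] (proj b '' A) := by
  obtain ⟨k, hk1, hk⟩ : ∃ k : ℝ, 1 < k ∧ k ^ 4 = K := by
    refine ⟨√(√K), ?_, ?_⟩
    · rw [Real.lt_sqrt (by norm_num), Real.lt_sqrt (by norm_num)]; simpa using hK
    · rw [show (4 : ℕ) = 2 * 2 by norm_num, pow_mul, Real.sq_sqrt (by positivity),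
        Real.sq_sqrt (by linarith)]
  have hdet : LinearMap.det (planeMap b c) ≠ 0 := by
    rw [← abs_pos, planeMap_det]; exact abs_pos.2 hne
  obtain ⟨M, hM0, hM⟩ := (planeMap b c).exists_antilipschitzWith
    (by
      have := ((planeMap b c).equivOfDetNeZero hdet).ker
      simpa using this)
  have hM' : ∀ y, ‖y‖ ≤ M * ‖planeMap b c y‖ := by
    intro y
    have := hM.le_mul_dist y 0
    simpa using this
  set L := planeMap b c with hL
  set η : ℝ := 1 - 1 / k with hη
  have hk0 : 0 < k := by linarith
  have hMp : (0 : ℝ) < M := by exact_mod_cast hM0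
  have hik : 1 / k < 1 := by rw [div_lt_one hk0]; exact hk1
  have hik0 : 0 < 1 / k := by positivity
  have hηp : 0 < η := by linarith
  refine ⟨min η (η / (k * M)), by positivity, fun A hA => ?_⟩
  set ε := min η (η / (k * M)) with hε
  have hεp : 0 < ε := by positivity
  have hε1 : ε ≤ η := min_le_left _ _
  have hε2 : ε * (k * M) ≤ η := by
    rw [← le_div_iff₀ (by positivity)]; exact min_le_right _ _
  have hkk : k * (1 / k) = 1 := by field_simp
  -- pointwise estimates
  have est2 : ∀ r ∈ A, ∀ s ∈ A, ‖r - s‖ ≤ k * ‖proj c (r - s)‖ := by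
    intro r hr s hs
    have h1 := proj_norm_sq c (r - s)
    have h2 := hA r hr s hs
    have h3 : ⟪c 2, r - s⟫ ^ 2 ≤ (ε * ‖r - s‖) ^ 2 := by
      rw [← sq_abs]; gcongr
    refine le_of_sq_le_sq ?_ (by positivity)
    rw [mul_pow, h1]
    have h4 : ε ^ 2 ≤ η ^ 2 := by gcongr
    have h5 : 1 ≤ k ^ 2 * (1 - η ^ 2) := by
      have : 1 - η ^ 2 = (1 / k) * (2 - 1 / k) := by rw [hη]; ring
      rw [this]
      have : k ^ 2 * (1 / k * (2 - 1 / k)) = k * (k * (1 / k)) * 2 - (k * (1 / k)) ^ 2 := by ring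
      rw [this, hkk]; linarith
    have h6 : (1 - η ^ 2) * ‖r - s‖ ^ 2 ≤ ‖r - s‖ ^ 2 - ⟪c 2, r - s⟫ ^ 2 := by
      have : ε ^ 2 * ‖r - s‖ ^ 2 ≤ η ^ 2 * ‖r - s‖ ^ 2 := by gcongr
      linarith [mul_pow ε ‖r - s‖ 2]
    calc ‖r - s‖ ^ 2 ≤ (k ^ 2 * (1 - η ^ 2)) * ‖r - s‖ ^ 2 := le_mul_of_one_le_left (by positivity) h5
      _ = k ^ 2 * ((1 - η ^ 2) * ‖r - s‖ ^ 2) := by ring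
      _ ≤ _ := by gcongr
  have est0 : ∀ r ∈ A, ∀ s ∈ A, ‖proj b (r - s) - L (proj c (r - s))‖ ≤ η * ‖L (proj c (r - s))‖ := by
    intro r hr s hs
    have h1 := proj_decomp b c (r - s)
    rw [← hL] at h1
    have h2 : proj b (r - s) - L (proj c (r - s)) = ⟪c 2, r - s⟫ • proj b (c 2) := by
      rw [h1]; abel
    rw [h2, norm_smul, Real.norm_eq_abs]
    have h3 : ‖proj b (c 2)‖ ≤ 1 := (proj_norm_le b _).trans (by simp)
    calc |⟪c 2, r - s⟫| * ‖proj b (c 2)‖ ≤ (ε * ‖r - s‖) * 1 := by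
          gcongr; exact hA r hr s hs
      _ ≤ ε * (k * (M * ‖L (proj c (r - s))‖)) := by
          rw [mul_one]; gcongr
          exact (est2 r hr s hs).trans (by gcongr; exact hM' _)
      _ = (ε * (k * M)) * ‖L (proj c (r - s))‖ := by ring
      _ ≤ _ := by gcongr
  have est3 : ∀ r ∈ A, ∀ s ∈ A, ‖proj b (r - s)‖ ≤ k * ‖L (proj c (r - s))‖ := by
    intro r hr s hs
    have h1 := est0 r hr s hs
    have h2 : ‖proj b (r - s)‖ ≤ (1 + η) * ‖L (proj c (r - s))‖ := by
      have := norm_le_norm_add_norm_sub' (proj b (r - s)) (L (proj c (r - s)))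
      linarith
    refine h2.trans ?_
    gcongr
    rw [hη]
    nlinarith
  have est4 : ∀ r ∈ A, ∀ s ∈ A, ‖L (proj c (r - s))‖ ≤ k * ‖proj b (r - s)‖ := by
    intro r hr s hs
    have h1 := est0 r hr s hs
    have h2 : (1 / k) * ‖L (proj c (r - s))‖ ≤ ‖proj b (r - s)‖ := by
      have := norm_le_norm_add_norm_sub (proj b (r - s)) (L (proj c (r - s)))
      have h3 : (1 / k) * ‖L (proj c (r - s))‖ = ‖L (proj c (r - s))‖ - η * ‖L (proj c (r - s))‖ := by
        rw [hη]; ring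
      linarith
    calc ‖L (proj c (r - s))‖ = (k * (1 / k)) * ‖L (proj c (r - s))‖ := by rw [hkk, one_mul]
      _ = k * ((1 / k) * ‖L (proj c (r - s))‖) := by ring
      _ ≤ _ := by gcongr
  set κ : ℝ≥0∞ := ENNReal.ofReal k ^ (2 : ℝ) with hκ
  have hKκ : ENNReal.ofReal K = κ * κ := by
    rw [hκ, ← hk, ENNReal.ofReal_pow hk0.le]
    rw [show ENNReal.ofReal k ^ (2 : ℝ) = ENNReal.ofReal k ^ 2 from by
      exact_mod_cast ENNReal.rpow_natCast (ENNReal.ofReal k) 2]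
    ring
  have hκ1 : 1 ≤ κ := by
    rw [hκ]
    exact ENNReal.one_le_rpow (by simpa using hk1.le) (by norm_num)
  have m1 : μH[2] (proj c '' A) ≤ μH[2] A := by
    have := hausdorff_compare (proj c) (id : E3 → E3) A 1 zero_le_one 2 (by norm_num)
      (by intro r _ s _; rw [dist_eq_norm, ← map_sub, one_mul]
          simpa [dist_eq_norm] using proj_norm_le c (r - s))
    simpa using this
  have m2 : μH[2] A ≤ κ * μH[2] (proj c '' A) := by
    have := hausdorff_compare (id : E3 → E3) (proj c) A k hk0.le 2 (by norm_num)
      (by intro r hr s hs; rw [dist_eq_norm, dist_eq_norm, ← map_sub]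
          exact est2 r hr s hs)
    rwa [image_id] at this
  have m3 : μH[2] (proj b '' A) ≤ κ * μH[2] ((fun x => L (proj c x)) '' A) := by
    exact hausdorff_compare (proj b) (fun x => L (proj c x)) A k hk0.le 2 (by norm_num)
      (by intro r hr s hs; rw [dist_eq_norm, dist_eq_norm, ← map_sub, ← map_sub, ← map_sub]
          exact est3 r hr s hs)
  have m4 : μH[2] ((fun x => L (proj c x)) '' A) ≤ κ * μH[2] (proj b '' A) := by
    exact hausdorff_compare (fun x => L (proj c x)) (proj b) A k hk0.le 2 (by norm_num)
      (by intro r hr s hs; rw [dist_eq_norm, dist_eq_norm, ← map_sub, ← map_sub, ← map_sub]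
          exact est4 r hr s hs)
  have m5 : μH[2] ((fun x => L (proj c x)) '' A) =
      ENNReal.ofReal |⟪b 2, c 2⟫| * μH[2] (proj c '' A) := by
    rw [← planeMap_det, ← hL, ← Measure.addHaar_image_linearMap, image_image]
  rw [hKκ]
  constructor
  · calc μH[2] (proj b '' A) ≤ κ * (ENNReal.ofReal |⟪b 2, c 2⟫| * μH[2] (proj c '' A)) := by
          rw [← m5]; exact m3
      _ ≤ (κ * κ) * (ENNReal.ofReal |⟪b 2, c 2⟫| * μH[2] A) := by
          gcongr
          exact le_mul_of_one_le_left (zero_le) hκ1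
  · calc ENNReal.ofReal |⟪b 2, c 2⟫| * μH[2] A
        ≤ ENNReal.ofReal |⟪b 2, c 2⟫| * (κ * μH[2] (proj c '' A)) := by gcongr
      _ = κ * μH[2] ((fun x => L (proj c x)) '' A) := by rw [m5]; ring
      _ ≤ κ * (κ * μH[2] (proj b '' A)) := by gcongr
      _ = _ := by ring

lemma local_null (n₁ n₂ : E3) (hli : LinearIndependent ℝ ![n₁, n₂]) :
    ∃ ε > 0, ∀ A : Set E3, (∀ r ∈ A, ∀ s ∈ A, |⟪n₁, r - s⟫| ≤ ε * ‖r - s‖ ∧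
      |⟪n₂, r - s⟫| ≤ ε * ‖r - s‖) → μH[2] A = 0 := by
  obtain ⟨w, hw⟩ := exists_linearIndependent_cons_of_lt_finrank (R := ℝ) (M := E3) (n := 2) hli
    (by rw [finrank_euclideanSpace_fin]; norm_num)
  set B : Fin 3 → E3 := Fin.cons w ![n₁, n₂] with hB
  have hspan := hw.span_eq_top_of_card_eq_finrank (by simp)
  let Λ : E3 →ₗ[ℝ] (Fin 3 → ℝ) := LinearMap.pi (fun i => (innerₛₗ ℝ (B i)))
  have hΛ : ∀ v i, Λ v i = ⟪B i, v⟫ := fun v i => rfl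
  have hker : Λ.ker = ⊥ := by
    rw [LinearMap.ker_eq_bot']
    intro v hv
    have h1 : ∀ x ∈ Submodule.span ℝ (range B), ⟪x, v⟫ = 0 := by
      intro x hx
      induction hx using Submodule.span_induction with
      | mem x hx => obtain ⟨i, rfl⟩ := hx; rw [← hΛ, hv]; rfl
      | zero => simp
      | add x y _ _ h1 h2 => rw [inner_add_left, h1, h2, add_zero]
      | smul a x _ h => rw [inner_smul_left, h, mul_zero]
    have := h1 v (by rw [hspan]; trivial)
    exact inner_self_eq_zero.1 this
  obtain ⟨M, hM0, hM⟩ := Λ.exists_antilipschitzWith hker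
  have hM' : ∀ y, ‖y‖ ≤ M * ‖Λ y‖ := by
    intro y
    have := hM.le_mul_dist y 0
    simpa using this
  have hMp : (0 : ℝ) < M := by exact_mod_cast hM0
  refine ⟨1 / (2 * M), by positivity, fun A hA => ?_⟩
  have key : ∀ r ∈ A, ∀ s ∈ A, ‖r - s‖ ≤ M * |⟪w, r - s⟫| := by
    intro r hr s hs
    obtain ⟨h1, h2⟩ := hA r hr s hs
    by_contra! hcon
    have hpos : 0 < ‖r - s‖ := lt_of_le_of_lt (by positivity) hcon
    have h3 : ‖Λ (r - s)‖ < 1 / M * ‖r - s‖ := by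
      rw [pi_norm_lt_iff (by positivity)]
      have h4 : 1 / (2 * (M : ℝ)) * ‖r - s‖ < 1 / M * ‖r - s‖ := by
        gcongr; linarith
      intro i
      rw [hΛ, Real.norm_eq_abs]
      fin_cases i
      · change |⟪w, r - s⟫| < _
        rw [one_div, ← div_eq_inv_mul, lt_div_iff₀ hMp]; linarith
      · exact h1.trans_lt h4
      · exact h2.trans_lt h4
    have := hM' (r - s)
    have h5 : M * ‖Λ (r - s)‖ < M * (1 / M * ‖r - s‖) := by gcongr
    have h6 : M * (1 / M * ‖r - s‖) = ‖r - s‖ := by field_simp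
    linarith
  have := hausdorff_compare (id : E3 → E3) (fun x => ⟪w, x⟫) A M hMp.le 2 (by norm_num)
      (by intro r hr s hs; rw [dist_eq_norm, dist_eq_norm, ← inner_sub_right]
          exact key r hr s hs)
  have hz : μH[2] ((fun x => ⟪w, x⟫) '' A) = 0 := by
    have := @hausdorffMeasure_of_dimH_lt ℝ _ _ _ ((fun x : E3 => ⟪w, x⟫) '' A) 2 (by
      refine (dimH_mono (subset_univ _)).trans_lt ?_
      rw [Real.dimH_univ]; norm_num)
    exact_mod_cast this
  rw [hz, mul_zero] at this
  simpa using this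

def RegS (C : Set E3) : Set E3 := {r | r ∈ frontier C ∧ IsRegularPt C r}
def IrrS (C : Set E3) : Set E3 := {r | r ∈ frontier C ∧ ¬ IsRegularPt C r}

lemma exists_normal_ray {C : Set E3} (hC : IsConvexBody C) {r u : E3} (hr : r ∈ C)
    (h : ∀ s : ℝ, 0 < s → r + s • u ∉ interior C) :
    ∃ n, IsOutwardNormalAt C r n ∧ 0 ≤ ⟪n, u⟫ := by
  obtain ⟨hcomp, hconv, x0, hx0⟩ := hC
  let T : Set E3 := {x | ∃ s : ℝ, 0 < s ∧ x = r + s • u}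
  have hT : Convex ℝ T := by
    rintro _ ⟨s, hs, rfl⟩ _ ⟨s', hs', rfl⟩ a b ha hb hab
    refine ⟨a * s + b * s', ?_, ?_⟩
    · rcases ha.eq_or_lt with rfl | ha
      · have : b = 1 := by linarith
        subst this; simpa using hs'
      · have := mul_pos ha hs
        have := mul_nonneg hb hs'.le
        linarith
    · have : r = (a + b) • r := by rw [hab, one_smul]
      rw [add_smul] at this
      nth_rw 3 [this]
      simp only [smul_add, add_smul, mul_smul]
      abel
  have hdisj : Disjoint (interior C) T := by
    rw [Set.disjoint_left]
    rintro _ hx ⟨s, hs, rfl⟩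
    exact h s hs hx
  obtain ⟨f, a, hf1, hf2⟩ := geometric_hahn_banach_open hconv.interior isOpen_interior hT hdisj
  have hf2' : ∀ s : ℝ, 0 < s → a ≤ f r + s * f u := by
    intro s hs
    have := hf2 (r + s • u) ⟨s, hs, rfl⟩
    simpa using this
  have hcl : C ⊆ closure (interior C) := by
    rw [hconv.closure_interior_eq_closure_of_nonempty_interior ⟨x0, hx0⟩]
    exact subset_closure
  have hfC : ∀ x ∈ C, f x ≤ a := by
    intro x hx
    have : closure (interior C) ⊆ {x | f x ≤ a} :=
      closure_minimal (fun y hy => (hf1 y hy).le) (isClosed_le f.continuous continuous_const)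
    exact this (hcl hx)
  have hfu : 0 ≤ f u := by
    have h1 := hf2' 1 one_pos
    have h2 := hfC r hr
    linarith
  have har : a ≤ f r := by
    apply le_of_forall_pos_le_add
    intro ε hε
    have := hf2' (ε / (f u + 1)) (by positivity)
    refine this.trans ?_
    gcongr
    rw [div_mul_eq_mul_div, div_le_iff₀ (by positivity)]
    nlinarith
  set n0 := (InnerProductSpace.toDual ℝ E3).symm f with hn0
  have hn : ∀ x, ⟪n0, x⟫ = f x := fun x => InnerProductSpace.toDual_symm_apply
  have hne : n0 ≠ 0 := by
    intro h0
    have h1 := hf1 x0 hx0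
    have e1 := hn x0
    have e2 := hn r
    rw [h0, inner_zero_left] at e1 e2
    linarith
  refine ⟨‖n0‖⁻¹ • n0, ⟨?_, ?_⟩, ?_⟩
  · rw [norm_smul, norm_inv, norm_norm, inv_mul_cancel₀ (norm_ne_zero_iff.2 hne)]
  · intro x hx
    rw [inner_smul_right, real_inner_comm, hn, map_sub]
    have := hfC x hx
    have h3 : 0 ≤ ‖n0‖⁻¹ := by positivity
    exact mul_nonpos_of_nonneg_of_nonpos h3 (by linarith)
  · rw [real_inner_smul_left, hn]
    positivity

lemma frontier_sub {C : Set E3} (hC : IsConvexBody C) : frontier C ⊆ C := hC.1.isClosed.frontier_subset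

lemma exists_normal {C : Set E3} (hC : IsConvexBody C) {r : E3} (hr : r ∈ frontier C) :
    ∃ n, IsOutwardNormalAt C r n := by
  obtain ⟨n, hn, -⟩ := exists_normal_ray hC (u := 0) (frontier_sub hC hr) (by
    intro s _
    simpa using hr.2)
  exact ⟨n, hn⟩

lemma normal_interior_lt {C : Set E3} {r n x : E3} (hn : IsOutwardNormalAt C r n)
    (hx : x ∈ interior C) : ⟪x - r, n⟫ < 0 := by
  have hc : Tendsto (fun s : ℝ => x + s • n) (𝓝[>] 0) (𝓝 x) := by
    have : Continuous (fun s : ℝ => x + s • n) := by fun_prop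
    have := this.tendsto 0
    simp only [zero_smul, add_zero] at this
    exact this.mono_left nhdsWithin_le_nhds
  have h1 := hc.eventually (mem_interior_iff_mem_nhds.1 hx)
  obtain ⟨s, hs, hs0⟩ := (h1.and self_mem_nhdsWithin).exists
  have h2 := hn.2 _ hs
  have h3 : x + s • n - r = (x - r) + s • n := by abel
  rw [h3, inner_add_left, real_inner_smul_left, real_inner_self_eq_norm_sq, hn.1] at h2
  have : 0 < s := hs0
  linarith

lemma normal_frontier {C : Set E3} {r n : E3} (hr : r ∈ C) (hn : IsOutwardNormalAt C r n) :
    r ∈ frontier C := by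
  refine ⟨subset_closure hr, fun h => ?_⟩
  have := normal_interior_lt hn h
  simp at this

lemma normals_indep {C : Set E3} (hC : IsConvexBody C) {r n₁ n₂ : E3}
    (h1 : IsOutwardNormalAt C r n₁) (h2 : IsOutwardNormalAt C r n₂) (hne : n₁ ≠ n₂) :
    LinearIndependent ℝ ![n₁, n₂] := by
  have h10 : n₁ ≠ 0 := by
    intro h; have := h1.1; rw [h, norm_zero] at this; norm_num at this
  rw [LinearIndependent.pair_iff' h10]
  intro a ha
  have h3 := h2.1
  rw [← ha, norm_smul, h1.1, mul_one, Real.norm_eq_abs] at h3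
  rcases eq_or_eq_neg_of_abs_eq h3 with rfl | rfl
  · exact hne (by simpa using ha)
  · obtain ⟨x, hx⟩ := hC.2.2
    have e1 := normal_interior_lt h1 hx
    have e2 := normal_interior_lt h2 hx
    rw [← ha, inner_smul_right] at e2
    linarith

lemma normals_close {C : Set E3} {r s n m n₀ : E3} {ε : ℝ} (hr : r ∈ C) (hs : s ∈ C)
    (hn : IsOutwardNormalAt C r n) (hm : IsOutwardNormalAt C s m)
    (h1 : ‖n - n₀‖ ≤ ε) (h2 : ‖m - n₀‖ ≤ ε) : |⟪n₀, r - s⟫| ≤ ε * ‖r - s‖ := by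
  have a1 := hn.2 s hs
  have a2 := hm.2 r hr
  have b1 : |⟪n - n₀, r - s⟫| ≤ ε * ‖r - s‖ :=
    (abs_real_inner_le_norm _ _).trans (by gcongr)
  have b2 : |⟪m - n₀, r - s⟫| ≤ ε * ‖r - s‖ :=
    (abs_real_inner_le_norm _ _).trans (by gcongr)
  rw [inner_sub_left] at b1 b2
  rw [abs_le] at b1 b2 ⊢
  have a1' : 0 ≤ ⟪n, r - s⟫ := by
    rw [← neg_sub r s, inner_neg_left, real_inner_comm] at a1; linarith
  rw [real_inner_comm] at a2
  constructor <;> linarith [b1.1, b1.2, b2.1, b2.2]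

lemma irr_null {C : Set E3} (hC : IsConvexBody C) : μH[2] (IrrS C) = 0 := by
  let P : Set (E3 × E3) := {p | LinearIndependent ℝ ![p.1, p.2]}
  have hloc : ∀ p : E3 × E3, ∃ ε > 0, p ∈ P → ∀ A : Set E3, (∀ r ∈ A, ∀ s ∈ A,
      |⟪p.1, r - s⟫| ≤ ε * ‖r - s‖ ∧ |⟪p.2, r - s⟫| ≤ ε * ‖r - s‖) → μH[2] A = 0 := by
    intro p
    by_cases hp : p ∈ P
    · obtain ⟨ε, h1, h2⟩ := local_null p.1 p.2 hp
      exact ⟨ε, h1, fun _ => h2⟩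
    · exact ⟨1, one_pos, fun h => absurd h hp⟩
  choose ε hε hA using hloc
  obtain ⟨t, htP, htc, htU⟩ := TopologicalSpace.countable_cover_nhdsWithin (s := P)
    (f := fun p => Metric.ball p (ε p)) (fun p _ => mem_nhdsWithin_of_mem_nhds (Metric.ball_mem_nhds p (hε p)))
  have hsub : IrrS C ⊆ ⋃ p ∈ t, {r | r ∈ C ∧ ∃ n₁ n₂, IsOutwardNormalAt C r n₁ ∧
      IsOutwardNormalAt C r n₂ ∧ (n₁, n₂) ∈ Metric.ball p (ε p)} := by
    rintro r ⟨hr, hirr⟩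
    obtain ⟨n₁, hn₁⟩ := exists_normal hC hr
    have : ∃ n₂, IsOutwardNormalAt C r n₂ ∧ n₁ ≠ n₂ := by
      by_contra! hcon
      exact hirr ⟨n₁, hn₁, fun y hy => (hcon y hy).symm⟩
    obtain ⟨n₂, hn₂, hne⟩ := this
    have := htU (show (n₁, n₂) ∈ P from normals_indep hC hn₁ hn₂ hne)
    simp only [mem_iUnion] at this ⊢
    obtain ⟨p, hp, hpb⟩ := this
    exact ⟨p, hp, frontier_sub hC hr, n₁, n₂, hn₁, hn₂, hpb⟩
  refine measure_mono_null hsub ?_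
  rw [measure_biUnion_null_iff htc]
  intro p hp
  apply hA p (htP hp)
  rintro r ⟨hr, n₁, n₂, h1, h2, h3⟩ s ⟨hs, m₁, m₂, k1, k2, k3⟩
  rw [Metric.mem_ball, Prod.dist_eq, max_lt_iff, dist_eq_norm, dist_eq_norm] at h3 k3
  exact ⟨normals_close hr hs h1 k1 h3.1.le k3.1.le, normals_close hr hs h2 k2 h3.2.le k3.2.le⟩

lemma isClosed_normals (C : Set E3) : IsClosed {p : E3 × E3 | IsOutwardNormalAt C p.1 p.2} := by
  have : {p : E3 × E3 | IsOutwardNormalAt C p.1 p.2} =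
      {p | ‖p.2‖ = 1} ∩ ⋂ x ∈ C, {p : E3 × E3 | ⟪x - p.1, p.2⟫ ≤ 0} := by
    ext p; simp [IsOutwardNormalAt]
  rw [this]
  refine (isClosed_eq (by fun_prop) (by fun_prop)).inter ?_
  exact isClosed_biInter fun x _ => isClosed_le (by fun_prop) (by fun_prop)

lemma isCompact_frontier' {C : Set E3} (hC : IsConvexBody C) : IsCompact (frontier C) :=
  hC.1.of_isClosed_subset isClosed_frontier (frontier_sub hC)

lemma isCompact_normals {C : Set E3} (hC : IsConvexBody C) :
    IsCompact {p : E3 × E3 | p.1 ∈ frontier C ∧ IsOutwardNormalAt C p.1 p.2} := by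
  refine ((isCompact_frontier' hC).prod (isCompact_sphere (0 : E3) 1)).of_isClosed_subset ?_ ?_
  · exact (isClosed_frontier.preimage continuous_fst).inter (isClosed_normals C)
  · rintro ⟨r, n⟩ ⟨h1, h2⟩
    exact ⟨h1, by simpa using h2.1⟩

lemma measurable_irr {C : Set E3} (hC : IsConvexBody C) : MeasurableSet (IrrS C) := by
  have hG := isCompact_normals hC
  set G := {p : E3 × E3 | p.1 ∈ frontier C ∧ IsOutwardNormalAt C p.1 p.2} with hGdef
  have : IrrS C = ⋃ k : ℕ, (fun q : (E3 × E3) × (E3 × E3) => q.1.1) ''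
      ((G ×ˢ G) ∩ {q | q.1.1 = q.2.1 ∧ 1 / ((k : ℝ) + 1) ≤ dist q.1.2 q.2.2}) := by
    ext r
    simp only [mem_iUnion]
    constructor
    · rintro ⟨hr, hirr⟩
      obtain ⟨n₁, hn₁⟩ := exists_normal hC hr
      have : ∃ n₂, IsOutwardNormalAt C r n₂ ∧ n₁ ≠ n₂ := by
        by_contra! hcon
        exact hirr ⟨n₁, hn₁, fun y hy => (hcon y hy).symm⟩
      obtain ⟨n₂, hn₂, hne⟩ := this
      obtain ⟨k, hk⟩ := exists_nat_one_div_lt (dist_pos.2 hne)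
      exact ⟨k, ((r, n₁), (r, n₂)), ⟨⟨⟨hr, hn₁⟩, ⟨hr, hn₂⟩⟩, rfl, hk.le⟩, rfl⟩
    · rintro ⟨k, ⟨⟨r1, n₁⟩, ⟨r2, n₂⟩⟩, ⟨⟨⟨h1, h2⟩, ⟨h3, h4⟩⟩, h5, h6⟩, h7⟩
      simp only at h1 h2 h3 h4 h5 h6 h7
      subst h5 h7
      refine ⟨h1, fun hreg => ?_⟩
      have := hreg.unique h2 h4
      rw [this, dist_self] at h6
      have : 0 < 1 / ((k : ℝ) + 1) := by positivity
      linarith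
  rw [this]
  refine MeasurableSet.iUnion fun k => (IsCompact.isClosed ?_).measurableSet
  refine ((hG.prod hG).inter_right ?_).image (by fun_prop)
  have c1 : IsClosed {q : (E3 × E3) × (E3 × E3) | q.1.1 = q.2.1} :=
    isClosed_eq (by fun_prop) (by fun_prop)
  have c2 : IsClosed {q : (E3 × E3) × (E3 × E3) | 1 / ((k : ℝ) + 1) ≤ dist q.1.2 q.2.2} :=
    isClosed_le (by fun_prop) (by fun_prop)
  exact c1.inter c2

lemma measurable_reg {C : Set E3} (hC : IsConvexBody C) : MeasurableSet (RegS C) := by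
  have : RegS C = frontier C \ IrrS C := by
    ext r; simp [RegS, IrrS]
  rw [this]
  exact isClosed_frontier.measurableSet.diff (measurable_irr hC)

lemma normalMap_spec {C : Set E3} {r : E3} (h : ∃ n, IsOutwardNormalAt C r n) :
    IsOutwardNormalAt C r (normalMap C r) := by
  unfold normalMap
  rw [dif_pos h]
  exact h.choose_spec

lemma normalMap_reg {C : Set E3} {r : E3} (h : IsRegularPt C r) :
    IsOutwardNormalAt C r (normalMap C r) := normalMap_spec h.exists

lemma normalMap_unique {C : Set E3} {r n : E3} (h : IsRegularPt C r) (hn : IsOutwardNormalAt C r n) :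
    normalMap C r = n := h.unique (normalMap_reg h) hn

lemma normalMap_continuousOn {C : Set E3} (hC : IsConvexBody C) :
    ContinuousOn (normalMap C) (RegS C) := by
  rw [continuousOn_iff_isClosed]
  intro F hF
  refine ⟨Prod.fst '' ({p : E3 × E3 | p.1 ∈ frontier C ∧ IsOutwardNormalAt C p.1 p.2} ∩ Prod.snd ⁻¹' F),
    (((isCompact_normals hC).inter_right (hF.preimage continuous_snd)).image continuous_fst).isClosed, ?_⟩
  ext r
  constructor
  · rintro ⟨h1, h2⟩
    exact ⟨⟨(r, normalMap C r), ⟨⟨h2.1, normalMap_reg h2.2⟩, h1⟩, rfl⟩, h2⟩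
  · rintro ⟨⟨⟨r', n⟩, ⟨⟨h1, h2⟩, h3⟩, rfl⟩, h4⟩
    refine ⟨?_, h4⟩
    change normalMap C r' ∈ F
    rw [normalMap_unique h4.2 h2]
    exact h3

lemma measurable_reg_preimage {C : Set E3} (hC : IsConvexBody C) {U : Set E3} (hU : IsOpen U) :
    MeasurableSet {r | r ∈ RegS C ∧ normalMap C r ∈ U} := by
  obtain ⟨V, hV, h⟩ := continuousOn_iff'.1 (normalMap_continuousOn hC) U hU
  have : {r | r ∈ RegS C ∧ normalMap C r ∈ U} = V ∩ RegS C := by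
    rw [← h]; ext r; exact and_comm
  rw [this]
  exact hV.measurableSet.inter (measurable_reg hC)

lemma area_local {C : Set E3} (hC : IsConvexBody C) (b : OrthonormalBasis (Fin 3) ℝ E3)
    (n : E3) (hn : ‖n‖ = 1) (hpos : 0 < ⟪b 2, n⟫) (K : ℝ) (hK : 1 < K) :
    ∃ ε > 0, ∀ B ⊆ RegS C, MeasurableSet B → (∀ r ∈ B, ‖normalMap C r - n‖ < ε) →
      μH[2] (proj b '' B) ≤ ENNReal.ofReal K * ∫⁻ r in B, ENNReal.ofReal ⟪b 2, normalMap C r⟫ ∂μH[2] ∧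
      ∫⁻ r in B, ENNReal.ofReal ⟪b 2, normalMap C r⟫ ∂μH[2] ≤ ENNReal.ofReal K * μH[2] (proj b '' B) := by
  obtain ⟨k, hk1, hk⟩ : ∃ k : ℝ, 1 < k ∧ k ^ 2 = K := by
    refine ⟨√K, ?_, ?_⟩
    · rw [Real.lt_sqrt (by norm_num)]; simpa using hK
    · rw [Real.sq_sqrt (by linarith)]
  obtain ⟨c, hc⟩ := exists_onb n hn
  subst hc
  obtain ⟨ε₁, hε₁, hA⟩ := local_area b c hpos.ne' k hk1
  set g := ⟪b 2, c 2⟫ with hg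
  have hcont : Continuous (fun m : E3 => ⟪b 2, m⟫) := by fun_prop
  have hev : ∀ᶠ m in 𝓝 (c 2), ⟪b 2, m⟫ < k * g ∧ g < k * ⟪b 2, m⟫ := by
    apply Filter.Eventually.and
    · exact (hcont.tendsto (c 2)).eventually_lt tendsto_const_nhds (by nlinarith)
    · have : Continuous (fun m : E3 => k * ⟪b 2, m⟫) := by fun_prop
      exact (tendsto_const_nhds).eventually_lt (this.tendsto (c 2)) (by
        change g < k * g
        nlinarith)
  obtain ⟨ε₂, hε₂, hball⟩ := Metric.eventually_nhds_iff.1 hev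
  refine ⟨min ε₁ ε₂, lt_min hε₁ hε₂, fun B hB hBm hBn => ?_⟩
  have hcl : ∀ r ∈ B, ∀ s ∈ B, |⟪c 2, r - s⟫| ≤ ε₁ * ‖r - s‖ := by
    intro r hr s hs
    exact normals_close (frontier_sub hC (hB hr).1) (frontier_sub hC (hB hs).1)
      (normalMap_reg (hB hr).2) (normalMap_reg (hB hs).2)
      ((hBn r hr).le.trans (min_le_left _ _)) ((hBn s hs).le.trans (min_le_left _ _))
  obtain ⟨h1, h2⟩ := hA B hcl
  rw [abs_of_pos hpos] at h1 h2
  have hk0 : 0 ≤ k := by linarith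
  have hfb : ∀ r ∈ B, ⟪b 2, normalMap C r⟫ < k * g ∧ g < k * ⟪b 2, normalMap C r⟫ := by
    intro r hr
    apply hball
    rw [dist_eq_norm]
    exact (hBn r hr).trans_le (min_le_right _ _)
  have e1 : ∫⁻ r in B, ENNReal.ofReal ⟪b 2, normalMap C r⟫ ∂μH[2] ≤
      ENNReal.ofReal k * (ENNReal.ofReal g * μH[2] B) := by
    rw [← mul_assoc, ← ENNReal.ofReal_mul hk0, ← setLIntegral_const]
    apply setLIntegral_mono' hBm
    intro r hr
    exact ENNReal.ofReal_le_ofReal (hfb r hr).1.le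
  have e2 : ENNReal.ofReal g * μH[2] B ≤
      ENNReal.ofReal k * ∫⁻ r in B, ENNReal.ofReal ⟪b 2, normalMap C r⟫ ∂μH[2] := by
    rw [← setLIntegral_const, ← lintegral_const_mul' _ _ ENNReal.ofReal_ne_top]
    apply setLIntegral_mono' hBm
    intro r hr
    rw [← ENNReal.ofReal_mul hk0]
    exact ENNReal.ofReal_le_ofReal (hfb r hr).2.le
  have hKk : ENNReal.ofReal K = ENNReal.ofReal k * ENNReal.ofReal k := by
    rw [← ENNReal.ofReal_mul hk0, ← hk, sq]
  rw [hKk]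
  constructor
  · rw [mul_assoc]
    exact h1.trans (by gcongr)
  · rw [mul_assoc]
    exact e1.trans (by gcongr)

def PosS (C : Set E3) (u : E3) : Set E3 := {r | r ∈ RegS C ∧ 0 < ⟪u, normalMap C r⟫}

lemma measurable_pos {C : Set E3} (hC : IsConvexBody C) (u : E3) : MeasurableSet (PosS C u) :=
  measurable_reg_preimage hC (U := {m | 0 < ⟪u, m⟫}) (isOpen_lt (by fun_prop) (by fun_prop))

lemma proj_eq_imp (b : OrthonormalBasis (Fin 3) ℝ E3) {r s : E3} (h : proj b r = proj b s) :
    r - s = ⟪b 2, r - s⟫ • b 2 := by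
  have h0 : proj b (r - s) = 0 := by rw [map_sub, h, sub_self]
  have h1 := b.sum_repr' (r - s)
  rw [Fin.sum_univ_three] at h1
  rw [proj_apply] at h0
  have a0 := congrArg (fun y : E2 => y 0) h0
  have a1 := congrArg (fun y : E2 => y 1) h0
  simp only [PiLp.zero_apply, Matrix.cons_val_zero, Matrix.cons_val_one] at a0 a1
  rw [a0, a1] at h1
  simpa using h1.symm

lemma proj_injOn_pos {C : Set E3} (hC : IsConvexBody C) (b : OrthonormalBasis (Fin 3) ℝ E3) :
    InjOn (proj b) (PosS C (b 2)) := by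
  intro r hr s hs h
  have h1 := proj_eq_imp b h
  set a := ⟪b 2, r - s⟫
  have a1 := (normalMap_reg hr.1.2).2 s (frontier_sub hC hs.1.1)
  have a2 := (normalMap_reg hs.1.2).2 r (frontier_sub hC hr.1.1)
  rw [← neg_sub r s, h1, inner_neg_left, real_inner_smul_left] at a1
  rw [h1, real_inner_smul_left] at a2
  have p1 := hr.2
  have p2 := hs.2
  have : a = 0 := by
    apply le_antisymm
    · by_contra! hc
      nlinarith [mul_pos hc p2]
    · by_contra! hc
      nlinarith [mul_pos (neg_pos.2 hc) p1]
  rw [this, zero_smul] at h1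
  exact sub_eq_zero.1 h1

lemma area_K {C : Set E3} (hC : IsConvexBody C) (b : OrthonormalBasis (Fin 3) ℝ E3)
    (K : ℝ) (hK : 1 < K) :
    μH[2] (proj b '' PosS C (b 2)) ≤
      ENNReal.ofReal K * ∫⁻ r in PosS C (b 2), ENNReal.ofReal ⟪b 2, normalMap C r⟫ ∂μH[2] ∧
    ∫⁻ r in PosS C (b 2), ENNReal.ofReal ⟪b 2, normalMap C r⟫ ∂μH[2] ≤
      ENNReal.ofReal K * μH[2] (proj b '' PosS C (b 2)) := by
  let Q : Set E3 := {n | ‖n‖ = 1 ∧ 0 < ⟪b 2, n⟫}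
  have hloc : ∀ n : E3, ∃ ε > 0, n ∈ Q → ∀ B ⊆ RegS C, MeasurableSet B → (∀ r ∈ B, ‖normalMap C r - n‖ < ε) →
      μH[2] (proj b '' B) ≤ ENNReal.ofReal K * ∫⁻ r in B, ENNReal.ofReal ⟪b 2, normalMap C r⟫ ∂μH[2] ∧
      ∫⁻ r in B, ENNReal.ofReal ⟪b 2, normalMap C r⟫ ∂μH[2] ≤ ENNReal.ofReal K * μH[2] (proj b '' B) := by
    intro n
    by_cases hn : n ∈ Q
    · obtain ⟨ε, h1, h2⟩ := area_local hC b n hn.1 hn.2 K hK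
      exact ⟨ε, h1, fun _ => h2⟩
    · exact ⟨1, one_pos, fun h => absurd h hn⟩
  choose ε hε hA using hloc
  obtain ⟨t, htP, htc, htU⟩ := TopologicalSpace.countable_cover_nhdsWithin (s := Q)
    (f := fun p => Metric.ball p (ε p)) (fun p _ => mem_nhdsWithin_of_mem_nhds (Metric.ball_mem_nhds p (hε p)))
  have hNQ : ∀ r ∈ PosS C (b 2), normalMap C r ∈ Q := fun r hr => ⟨(normalMap_reg hr.1.2).1, hr.2⟩
  rcases t.eq_empty_or_nonempty with rfl | htne
  · have : PosS C (b 2) = ∅ := by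
      rw [eq_empty_iff_forall_notMem]
      intro r hr
      have := htU (hNQ r hr)
      simp at this
    simp [this]
  obtain ⟨g, rfl⟩ := htc.exists_eq_range htne
  set A := PosS C (b 2) with hAdef
  let D : ℕ → Set E3 := fun i => A ∩ {r | r ∈ RegS C ∧ normalMap C r ∈ Metric.ball (g i) (ε (g i))}
  have hDm : ∀ i, MeasurableSet (D i) := fun i =>
    (measurable_pos hC _).inter (measurable_reg_preimage hC Metric.isOpen_ball)
  have hDU : ⋃ i, D i = A := by
    apply subset_antisymm
    · exact iUnion_subset fun i => inter_subset_left
    · intro r hr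
      have := htU (hNQ r hr)
      simp only [mem_iUnion, mem_range, exists_prop, exists_exists_eq_and] at this
      obtain ⟨i, hi⟩ := this
      exact mem_iUnion.2 ⟨i, hr, hr.1, hi⟩
  let E : ℕ → Set E3 := disjointed D
  have hEm : ∀ i, MeasurableSet (E i) := fun i => MeasurableSet.disjointed hDm i
  have hEd : Pairwise (Function.onFun Disjoint E) := disjoint_disjointed D
  have hEU : ⋃ i, E i = A := by rw [← hDU]; exact iUnion_disjointed
  have hED : ∀ i, E i ⊆ D i := fun i => disjointed_subset D i
  have hEA : ∀ i, E i ⊆ A := fun i => (hED i).trans inter_subset_left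
  have hloc2 : ∀ i, _ := fun i => hA (g i) (htP ⟨i, rfl⟩) (E i) (fun r hr => (hEA i hr).1) (hEm i)
    (fun r hr => by
      have := (hED i hr).2.2
      rwa [Metric.mem_ball, dist_eq_norm] at this)
  have hinj := proj_injOn_pos hC b
  have s1 : μH[2] (proj b '' A) = ∑' i, μH[2] (proj b '' E i) := by
    rw [← hEU, image_iUnion]
    apply measure_iUnion
    · intro i j hij
      exact (hEd hij).image hinj (hEA i) (hEA j)
    · intro i
      exact (hEm i).image_of_continuousOn_injOn (proj b).continuous.continuousOn (hinj.mono (hEA i))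
  have s2 : ∫⁻ r in A, ENNReal.ofReal ⟪b 2, normalMap C r⟫ ∂μH[2] =
      ∑' i, ∫⁻ r in E i, ENNReal.ofReal ⟪b 2, normalMap C r⟫ ∂μH[2] := by
    conv_lhs => rw [← hEU]
    exact lintegral_iUnion hEm hEd _
  rw [s1, s2, ← ENNReal.tsum_mul_left, ← ENNReal.tsum_mul_left]
  exact ⟨ENNReal.tsum_le_tsum fun i => (hloc2 i).1, ENNReal.tsum_le_tsum fun i => (hloc2 i).2⟩

lemma le_of_forall_K {x y : ℝ≥0∞} (h : ∀ K : ℝ, 1 < K → x ≤ ENNReal.ofReal K * y) : x ≤ y := by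
  have h1 : Tendsto (fun K : ℝ => ENNReal.ofReal K * y) (𝓝[>] 1) (𝓝 (ENNReal.ofReal 1 * y)) := by
    apply ENNReal.Tendsto.mul_const
    · exact (ENNReal.continuous_ofReal.tendsto 1).mono_left nhdsWithin_le_nhds
    · left; simp
  rw [ENNReal.ofReal_one, one_mul] at h1
  refine ge_of_tendsto h1 ?_
  filter_upwards [self_mem_nhdsWithin] with K hK using h K hK

lemma area_formula {C : Set E3} (hC : IsConvexBody C) (b : OrthonormalBasis (Fin 3) ℝ E3) :
    ∫⁻ r in PosS C (b 2), ENNReal.ofReal ⟪b 2, normalMap C r⟫ ∂μH[2] =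
      μH[2] (proj b '' PosS C (b 2)) :=
  le_antisymm (le_of_forall_K fun K hK => (area_K hC b K hK).2)
    (le_of_forall_K fun K hK => (area_K hC b K hK).1)

lemma proj_inner (b : OrthonormalBasis (Fin 3) ℝ E3) (x n : E3) (h : ⟪b 2, n⟫ = 0) :
    ⟪proj b x, proj b n⟫ = ⟪x, n⟫ := by
  have h1 := b.sum_inner_mul_inner x n
  rw [Fin.sum_univ_three, h, mul_zero, add_zero] at h1
  rw [← h1, proj_apply, proj_apply]
  simp [PiLp.inner_apply, Fin.sum_univ_two, mul_comm]

lemma proj_cover {C : Set E3} (hC : IsConvexBody C) (b : OrthonormalBasis (Fin 3) ℝ E3) :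
    interior (proj b '' C) ⊆ proj b '' PosS C (b 2) ∪ proj b '' IrrS C := by
  intro y hy
  obtain ⟨r₁, hr₁, hry₁⟩ := interior_subset hy
  have hcomp : IsCompact (C ∩ {x | proj b x = y}) :=
    hC.1.inter_right (isClosed_eq (proj b).continuous continuous_const)
  obtain ⟨r, ⟨hrC, hry⟩, hmax⟩ := hcomp.exists_isMaxOn ⟨r₁, hr₁, hry₁⟩
    (f := fun x => ⟪b 2, x⟫) (by fun_prop)
  have hpb : proj b (b 2) = 0 := by
    have := proj_norm_sq b (b 2)
    simp at this
    exact this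
  have hray : ∀ s : ℝ, 0 < s → r + s • b 2 ∉ interior C := by
    intro s hs hInt
    have h1 : r + s • b 2 ∈ C ∩ {x | proj b x = y} := by
      refine ⟨interior_subset hInt, ?_⟩
      change proj b (r + s • b 2) = y
      rw [map_add, map_smul, hpb, smul_zero, add_zero]; exact hry
    have h2 := hmax h1
    simp [inner_add_right, inner_smul_right] at h2
    linarith
  obtain ⟨n, hn, hnu⟩ := exists_normal_ray hC hrC hray
  have hfr : r ∈ frontier C := normal_frontier hrC hn
  by_cases hreg : IsRegularPt C r
  · left
    refine ⟨r, ⟨⟨hfr, hreg⟩, ?_⟩, hry⟩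
    rw [normalMap_unique hreg hn]
    rw [real_inner_comm] at hnu
    refine lt_of_le_of_ne hnu fun h0 => ?_
    have h0 := h0.symm
    have hpn : ‖proj b n‖ = 1 := by
      have := proj_norm_sq b n
      rw [h0, hn.1] at this
      nlinarith [norm_nonneg (proj b n)]
    have hc : Tendsto (fun s : ℝ => y + s • proj b n) (𝓝[>] 0) (𝓝 y) := by
      have : Continuous (fun s : ℝ => y + s • proj b n) := by fun_prop
      have := this.tendsto 0
      simp only [zero_smul, add_zero] at this
      exact this.mono_left nhdsWithin_le_nhds
    have h1 := hc.eventually (mem_interior_iff_mem_nhds.1 hy)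
    obtain ⟨s, ⟨x, hx, hxs⟩, hs0⟩ := (h1.and self_mem_nhdsWithin).exists
    have h2 := hn.2 x hx
    rw [← proj_inner b _ _ h0, map_sub, hxs, hry, add_sub_cancel_left, real_inner_smul_left,
      real_inner_self_eq_norm_sq, hpn] at h2
    have : 0 < s := hs0
    linarith
  · right
    exact ⟨r, ⟨hfr, hreg⟩, hry⟩

lemma proj_measure_le (b : OrthonormalBasis (Fin 3) ℝ E3) (A : Set E3) :
    μH[2] (proj b '' A) ≤ μH[2] A := by
  have := hausdorff_compare (proj b) (id : E3 → E3) A 1 zero_le_one 2 (by norm_num)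
      (by intro r _ s _; rw [dist_eq_norm, ← map_sub, one_mul]
          simpa [dist_eq_norm] using proj_norm_le b (r - s))
  simpa using this

lemma proj_full {C : Set E3} (hC : IsConvexBody C) (b : OrthonormalBasis (Fin 3) ℝ E3) :
    μH[2] (proj b '' PosS C (b 2)) = μH[2] (proj b '' C) := by
  apply le_antisymm
  · apply measure_mono
    apply image_mono
    intro r hr
    exact frontier_sub hC hr.1.1
  · have hconv : Convex ℝ (proj b '' C) := hC.2.1.linear_image (proj b).toLinearMap
    have h1 : proj b '' C ⊆ (interior (proj b '' C)) ∪ frontier (proj b '' C) := by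
      rw [← closure_eq_interior_union_frontier]; exact subset_closure
    have h0 : μH[2] (proj b '' IrrS C) = 0 :=
      le_antisymm ((proj_measure_le b _).trans (irr_null hC).le) zero_le
    calc μH[2] (proj b '' C) ≤ μH[2] (interior (proj b '' C)) + μH[2] (frontier (proj b '' C)) :=
          (measure_mono h1).trans (measure_union_le _ _)
      _ = μH[2] (interior (proj b '' C)) := by rw [hconv.addHaar_frontier (μH[2] : Measure E2), add_zero]
      _ ≤ μH[2] (proj b '' PosS C (b 2)) + μH[2] (proj b '' IrrS C) :=
          (measure_mono (proj_cover hC b)).trans (measure_union_le _ _)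
      _ = _ := by rw [h0, add_zero]

lemma lintegral_reg {C : Set E3} (hC : IsConvexBody C) (b : OrthonormalBasis (Fin 3) ℝ E3) :
    ∫⁻ r in RegS C, ENNReal.ofReal ⟪b 2, normalMap C r⟫ ∂μH[2] = μH[2] (proj b '' C) := by
  rw [← proj_full hC b, ← area_formula hC b,
    ← lintegral_inter_add_sdiff _ (RegS C) (measurable_pos hC (b 2))]
  have h1 : RegS C ∩ PosS C (b 2) = PosS C (b 2) :=
    inter_eq_self_of_subset_right fun r hr => hr.1
  have h2 : ∫⁻ r in RegS C \ PosS C (b 2), ENNReal.ofReal ⟪b 2, normalMap C r⟫ ∂μH[2] = 0 := by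
    rw [setLIntegral_congr_fun (g := fun _ => 0) ((measurable_reg hC).diff (measurable_pos hC _))]
    · simp
    · intro r hr
      apply ENNReal.ofReal_of_nonpos
      by_contra! hc
      exact hr.2 ⟨hr.1, hc⟩
  rw [h1, h2, add_zero]

lemma proj_indep (b bb : OrthonormalBasis (Fin 3) ℝ E3) (h : bb 2 = - b 2) (A : Set E3) :
    μH[2] (proj b '' A) = μH[2] (proj bb '' A) := by
  have hn : ∀ x, ‖proj b x‖ = ‖proj bb x‖ := by
    intro x
    have h1 := proj_norm_sq b x
    have h2 := proj_norm_sq bb x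
    rw [h, inner_neg_left, neg_sq, ← h1] at h2
    exact ((sq_eq_sq₀ (norm_nonneg _) (norm_nonneg _)).1 h2).symm
  apply le_antisymm
  · have := hausdorff_compare (proj b) (proj bb) A 1 zero_le_one 2 (by norm_num)
      (by intro r _ s _; rw [dist_eq_norm, dist_eq_norm, ← map_sub, ← map_sub, one_mul, hn])
    simpa using this
  · have := hausdorff_compare (proj bb) (proj b) A 1 zero_le_one 2 (by norm_num)
      (by intro r _ s _; rw [dist_eq_norm, dist_eq_norm, ← map_sub, ← map_sub, one_mul, hn])
    simpa using this

lemma lintegral_flux {C : Set E3} (hC : IsConvexBody C) (u : E3) (hu : ‖u‖ = 1) :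
    ∫⁻ r in RegS C, ENNReal.ofReal ⟪u, normalMap C r⟫ ∂μH[2] < ∞ ∧
    ∫⁻ r in RegS C, ENNReal.ofReal (-⟪u, normalMap C r⟫) ∂μH[2] =
      ∫⁻ r in RegS C, ENNReal.ofReal ⟪u, normalMap C r⟫ ∂μH[2] := by
  obtain ⟨b, rfl⟩ := exists_onb u hu
  obtain ⟨b', hb'⟩ := exists_onb (- b 2) (by simp)
  have h1 := lintegral_reg hC b
  have h2 := lintegral_reg hC b'
  rw [hb'] at h2
  simp only [inner_neg_left] at h2
  rw [h1, h2]
  exact ⟨(hC.1.image (proj b).continuous).measure_lt_top, (proj_indep b b' hb' C).symm⟩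

lemma aemeas_normal {C : Set E3} (hC : IsConvexBody C) :
    AEMeasurable (normalMap C) (μH[2].restrict (RegS C)) :=
  (normalMap_continuousOn hC).aemeasurable (measurable_reg hC)

lemma reg_finite {C : Set E3} (hC : IsConvexBody C) : μH[2] (RegS C) < ∞ := by
  let b := EuclideanSpace.basisFun (Fin 3) ℝ
  have hN := aemeas_normal hC
  have hm : ∀ u : E3, AEMeasurable (fun r => ENNReal.ofReal ⟪u, normalMap C r⟫) (μH[2].restrict (RegS C)) :=
    fun u => ((hN.const_inner (c := u))).ennreal_ofReal
  have hle : ∀ r ∈ RegS C, (1 : ℝ≥0∞) ≤ ∑ i : Fin 3, (ENNReal.ofReal ⟪b i, normalMap C r⟫ +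
      ENNReal.ofReal (-⟪b i, normalMap C r⟫)) := by
    intro r hr
    have hn := (normalMap_reg hr.2).1
    set n := normalMap C r
    have habs : ∀ x : ℝ, ENNReal.ofReal x + ENNReal.ofReal (-x) = ENNReal.ofReal |x| := by
      intro x
      rcases le_total 0 x with h | h
      · rw [ENNReal.ofReal_of_nonpos (neg_nonpos.2 h), add_zero, abs_of_nonneg h]
      · rw [ENNReal.ofReal_of_nonpos h, zero_add, abs_of_nonpos h]
    simp only [habs]
    rw [← ENNReal.ofReal_sum_of_nonneg (fun i _ => abs_nonneg _), ← ENNReal.ofReal_one]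
    apply ENNReal.ofReal_le_ofReal
    calc (1 : ℝ) = ‖n‖ := hn.symm
      _ = ‖∑ i, ⟪b i, n⟫ • b i‖ := by rw [b.sum_repr']
      _ ≤ ∑ i, ‖⟪b i, n⟫ • b i‖ := norm_sum_le _ _
      _ = _ := by simp [norm_smul]
  calc μH[2] (RegS C) = ∫⁻ r in RegS C, 1 ∂μH[2] := by simp
    _ ≤ ∫⁻ r in RegS C, ∑ i : Fin 3, (ENNReal.ofReal ⟪b i, normalMap C r⟫ +
      ENNReal.ofReal (-⟪b i, normalMap C r⟫)) ∂μH[2] := setLIntegral_mono' (measurable_reg hC) hle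
    _ = ∑ i : Fin 3, ∫⁻ r in RegS C, (ENNReal.ofReal ⟪b i, normalMap C r⟫ +
      ENNReal.ofReal (-⟪b i, normalMap C r⟫)) ∂μH[2] := by
        apply lintegral_finsetSum'
        intro i _
        refine (hm _).add ?_
        simpa only [inner_neg_left] using hm (-b i)
    _ < ∞ := by
        rw [ENNReal.sum_lt_top]
        intro i _
        rw [lintegral_add_left' (hm _)]
        obtain ⟨h1, h2⟩ := lintegral_flux hC (b i) (by simp)
        rw [h2]
        exact ENNReal.add_lt_top.2 ⟨h1, h1⟩

lemma normal_integrable {C : Set E3} (hC : IsConvexBody C) :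
    IntegrableOn (normalMap C) (RegS C) μH[2] := by
  have : IsFiniteMeasure (μH[2].restrict (RegS C)) := ⟨by simpa using reg_finite hC⟩
  refine Integrable.of_bound (C := 1) (aemeas_normal hC).aestronglyMeasurable ?_
  rw [ae_restrict_iff' (measurable_reg hC)]
  exact Eventually.of_forall fun r hr => (normalMap_reg hr.2).1.le

lemma flux_zero {C : Set E3} (hC : IsConvexBody C) : ∫ r in RegS C, normalMap C r ∂μH[2] = 0 := by
  have hInt := normal_integrable hC
  have hu : ∀ u : E3, ‖u‖ = 1 → ⟪u, ∫ r in RegS C, normalMap C r ∂μH[2]⟫ = 0 := by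
    intro u hu
    rw [← integral_inner hInt u]
    rw [integral_eq_lintegral_pos_part_sub_lintegral_neg_part (hInt.const_inner u),
      (lintegral_flux hC u hu).2, sub_self]
  by_contra hne
  set v := ∫ r in RegS C, normalMap C r ∂μH[2]
  have h1 := hu (‖v‖⁻¹ • v) (by
    rw [norm_smul, norm_inv, norm_norm, inv_mul_cancel₀ (norm_ne_zero_iff.2 hne)])
  rw [real_inner_smul_left, real_inner_self_eq_norm_sq] at h1
  have : 0 < ‖v‖ := norm_pos_iff.2 hne
  have : 0 < ‖v‖⁻¹ * ‖v‖ ^ 2 := by positivity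
  linarith

def capS (C : Set E3) (r₀ e : E3) (t : ℝ) : Set E3 := C ∩ {r | -t ≤ ⟪r - r₀, e⟫}

lemma cap_body {C : Set E3} (hC : IsConvexBody C) {r₀ e z : E3} {t : ℝ} (he : ‖e‖ = 1)
    (hz : z ∈ interior C) (hzt : ⟪z - r₀, e⟫ = -t) : IsConvexBody (capS C r₀ e t) := by
  have hcl : IsClosed {r : E3 | -t ≤ ⟪r - r₀, e⟫} := isClosed_le (by fun_prop) (by fun_prop)
  refine ⟨hC.1.inter_right hcl, hC.2.1.inter ?_, ?_⟩
  · intro x hx y hy a b ha hb hab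
    have hx' : -t ≤ ⟪x - r₀, e⟫ := hx
    have hy' : -t ≤ ⟪y - r₀, e⟫ := hy
    change -t ≤ ⟪a • x + b • y - r₀, e⟫
    have : a • x + b • y - r₀ = a • (x - r₀) + b • (y - r₀) := by
      have : r₀ = (a + b) • r₀ := by rw [hab, one_smul]
      nth_rw 1 [this]
      simp only [smul_sub, add_smul]; abel
    rw [this, inner_add_left, real_inner_smul_left, real_inner_smul_left]
    have h1 := mul_le_mul_of_nonneg_left hx' ha
    have h2 := mul_le_mul_of_nonneg_left hy' hb
    have : a * -t + b * -t = -t := by rw [← add_mul, hab, one_mul]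
    linarith
  · have hc : Tendsto (fun s : ℝ => z + s • e) (𝓝[>] 0) (𝓝 z) := by
      have : Continuous (fun s : ℝ => z + s • e) := by fun_prop
      have := this.tendsto 0
      simp only [zero_smul, add_zero] at this
      exact this.mono_left nhdsWithin_le_nhds
    have h1 := hc.eventually (isOpen_interior.mem_nhds hz)
    obtain ⟨s, hs, hs0⟩ := (h1.and self_mem_nhdsWithin).exists
    have hop : IsOpen (interior C ∩ {r : E3 | -t < ⟪r - r₀, e⟫}) :=
      isOpen_interior.inter (isOpen_lt (by fun_prop) (by fun_prop))
    refine ⟨z + s • e, interior_maximal ?_ hop ⟨hs, ?_⟩⟩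
    · rintro x ⟨hx1, hx2⟩
      exact ⟨interior_subset hx1, (show -t < ⟪x - r₀, e⟫ from hx2).le⟩
    · change -t < ⟪z + s • e - r₀, e⟫
      have : z + s • e - r₀ = (z - r₀) + s • e := by abel
      rw [this, inner_add_left, real_inner_smul_left, real_inner_self_eq_norm_sq, he, hzt]
      have : 0 < s := hs0
      linarith

lemma cap_normal_iff {C : Set E3} (hC : IsConvexBody C) {r₀ e r : E3} {t : ℝ} (hr : r ∈ C)
    (hrt : -t < ⟪r - r₀, e⟫) (n : E3) :
    IsOutwardNormalAt (capS C r₀ e t) r n ↔ IsOutwardNormalAt C r n := by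
  constructor
  · rintro ⟨h1, h2⟩
    refine ⟨h1, fun x hx => ?_⟩
    have hc : Tendsto (fun s : ℝ => ⟪r + s • (x - r) - r₀, e⟫) (𝓝[>] 0) (𝓝 ⟪r - r₀, e⟫) := by
      have : Continuous (fun s : ℝ => ⟪r + s • (x - r) - r₀, e⟫) := by fun_prop
      have := this.tendsto 0
      simp only [zero_smul, add_zero] at this
      exact this.mono_left nhdsWithin_le_nhds
    have h3 := hc.eventually (lt_mem_nhds hrt)
    have h4 : ∀ᶠ s : ℝ in 𝓝[>] 0, s < 1 :=
      (eventually_lt_nhds one_pos).filter_mono nhdsWithin_le_nhds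
    obtain ⟨s, ⟨hs, hs1⟩, hs0⟩ := ((h3.and h4).and self_mem_nhdsWithin).exists
    have hs0 : 0 < s := hs0
    have h5 : r + s • (x - r) ∈ C := hC.2.1.add_smul_sub_mem hr hx ⟨hs0.le, hs1.le⟩
    have h6 := h2 _ ⟨h5, le_of_lt hs⟩
    rw [add_sub_cancel_left, real_inner_smul_left] at h6
    by_contra! hcon
    nlinarith [mul_pos hs0 hcon]
  · rintro ⟨h1, h2⟩
    exact ⟨h1, fun x hx => h2 x hx.1⟩

lemma cap_regular_iff {C : Set E3} (hC : IsConvexBody C) {r₀ e r : E3} {t : ℝ} (hr : r ∈ C)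
    (hrt : -t < ⟪r - r₀, e⟫) : IsRegularPt (capS C r₀ e t) r ↔ IsRegularPt C r := by
  unfold IsRegularPt
  simp only [cap_normal_iff hC hr hrt]

lemma cap_plane_normal {C : Set E3} {r₀ e r : E3} {t : ℝ} (he : ‖e‖ = 1)
    (hrt : ⟪r - r₀, e⟫ = -t) : IsOutwardNormalAt (capS C r₀ e t) r (-e) := by
  refine ⟨by rwa [norm_neg], fun x hx => ?_⟩
  have h1 : -t ≤ ⟪x - r₀, e⟫ := hx.2
  have : x - r = (x - r₀) - (r - r₀) := by abel
  rw [this, inner_neg_right, inner_sub_left, hrt]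
  linarith

lemma B_finite {C : Set E3} (hC : IsConvexBody C) {r₀ e z : E3} {t : ℝ} (he : ‖e‖ = 1)
    (hz : z ∈ interior C) (hzt : ⟪z - r₀, e⟫ = -t) : μH[2] (Bset C r₀ e t) < ∞ := by
  have hK := cap_body hC he hz hzt
  have hsub : Bset C r₀ e t ⊆ RegS (capS C r₀ e t) ∪ IrrS (capS C r₀ e t) := by
    rintro r ⟨hr, hrt⟩
    have hrt : ⟪r - r₀, e⟫ = -t := hrt
    have hf : r ∈ frontier (capS C r₀ e t) :=
      normal_frontier ⟨hr, hrt.ge⟩ (cap_plane_normal he hrt)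
    by_cases h : IsRegularPt (capS C r₀ e t) r
    · exact Or.inl ⟨hf, h⟩
    · exact Or.inr ⟨hf, h⟩
  refine ((measure_mono hsub).trans (measure_union_le _ _)).trans_lt ?_
  rw [irr_null hK, add_zero]
  exact reg_finite hK

lemma B_pos {C : Set E3} {r₀ e z : E3} {t : ℝ} (he : ‖e‖ = 1)
    (hz : z ∈ interior C) (hzt : ⟪z - r₀, e⟫ = -t) : 0 < μH[2] (Bset C r₀ e t) := by
  obtain ⟨b, rfl⟩ := exists_onb e he
  let f : E2 → E3 := fun y => z + (y 0 • b 0 + y 1 • b 1)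
  have hf : Continuous f := by fun_prop
  have o20 : ⟪b 0, b 2⟫ = 0 := b.orthonormal.2 (by decide)
  have o21 : ⟪b 1, b 2⟫ = 0 := b.orthonormal.2 (by decide)
  have o10 : ⟪b 1, b 0⟫ = 0 := b.orthonormal.2 (by decide)
  have o01 : ⟪b 0, b 1⟫ = 0 := b.orthonormal.2 (by decide)
  let U : Set E2 := f ⁻¹' interior C
  have hU : IsOpen U := isOpen_interior.preimage hf
  have hU0 : (0 : E2) ∈ U := by
    change f 0 ∈ interior C
    simpa [f] using hz
  have h1 : 0 < μH[2] U := hU.measure_pos _ ⟨0, hU0⟩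
  have hpf : ∀ y, proj b (f y) = proj b z + y := by
    intro y
    simp only [f]
    rw [map_add, proj_apply b (y 0 • b 0 + y 1 • b 1)]
    congr 1
    ext i
    fin_cases i <;> simp [inner_add_right, inner_smul_right, o10, o01]
  have h2 : μH[2] U ≤ μH[2] (f '' U) := by
    have := hausdorff_compare (id : E2 → E2) f U 1 zero_le_one 2 (by norm_num)
      (by
        intro y _ y' _
        have h3 := proj_norm_le b (f y - f y')
        rw [map_sub, hpf, hpf, add_sub_add_left_eq_sub] at h3
        rw [one_mul, dist_eq_norm, dist_eq_norm]
        exact h3)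
    simpa using this
  refine h1.trans_le (h2.trans (measure_mono ?_))
  rintro _ ⟨y, hy, rfl⟩
  refine ⟨interior_subset hy, ?_⟩
  change ⟪z + (y 0 • b 0 + y 1 • b 1) - r₀, b 2⟫ = -t
  have : z + (y 0 • b 0 + y 1 • b 1) - r₀ = (z - r₀) + (y 0 • b 0 + y 1 • b 1) := by abel
  rw [this, inner_add_left, inner_add_left, real_inner_smul_left, real_inner_smul_left, o20, o21, hzt]
  simp

lemma S_flux {C : Set E3} (hC : IsConvexBody C) {r₀ e z : E3} {t : ℝ} (he : ‖e‖ = 1)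
    (hz : z ∈ interior C) (hzt : ⟪z - r₀, e⟫ = -t) :
    ∫ r in Sset C r₀ e t ∩ {r | IsRegularPt C r}, normalMap C r ∂μH[2] =
      (μH[2] (Bset C r₀ e t)).toReal • e := by
  have hK := cap_body hC he hz hzt
  set K := capS C r₀ e t with hKdef
  let H : Set E3 := {r | -t < ⟪r - r₀, e⟫}
  have hHm : MeasurableSet H := (isOpen_lt (by fun_prop) (by fun_prop) : IsOpen H).measurableSet
  -- the regular points of the cap off the plane
  have hregeq : RegS K ∩ H = RegS C ∩ H := by
    ext r
    constructor
    · rintro ⟨⟨h1, h2⟩, h3⟩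
      have hrC : r ∈ C := (frontier_sub hK h1).1
      have h4 := (cap_regular_iff hC hrC h3).1 h2
      exact ⟨⟨normal_frontier hrC (normalMap_reg h4), h4⟩, h3⟩
    · rintro ⟨⟨h1, h2⟩, h3⟩
      have hrC : r ∈ C := frontier_sub hC h1
      have h4 := (cap_regular_iff hC hrC h3).2 h2
      exact ⟨⟨normal_frontier ⟨hrC, (show -t < ⟪r - r₀, e⟫ from h3).le⟩ (normalMap_reg h4), h4⟩, h3⟩
  have hnormeq : ∀ r ∈ RegS C ∩ H, normalMap C r = normalMap K r := by
    rintro r ⟨⟨h1, h2⟩, h3⟩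
    have hrC : r ∈ C := frontier_sub hC h1
    have h4 := (cap_regular_iff hC hrC h3).2 h2
    exact normalMap_unique h2 ((cap_normal_iff hC hrC h3 _).1 (normalMap_reg h4))
  -- step 1
  have hS : ∫ r in Sset C r₀ e t ∩ {r | IsRegularPt C r}, normalMap C r ∂μH[2] =
      ∫ r in RegS C ∩ H, normalMap C r ∂μH[2] := by
    apply setIntegral_congr_set
    have hsub1 : RegS C ∩ H ⊆ Sset C r₀ e t ∩ {r | IsRegularPt C r} := by
      rintro r ⟨⟨h1, h2⟩, h3⟩
      exact ⟨⟨h1, (show -t < ⟪r - r₀, e⟫ from h3).le⟩, h2⟩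
    have hdiff : μH[2] ((Sset C r₀ e t ∩ {r | IsRegularPt C r}) \ (RegS C ∩ H)) = 0 := by
      refine measure_mono_null ?_ (irr_null hK)
      rintro r ⟨⟨⟨h1, h2⟩, h3⟩, h4⟩
      have h2 : -t ≤ ⟪r - r₀, e⟫ := h2
      have h5 : ⟪r - r₀, e⟫ = -t := by
        apply le_antisymm _ h2
        by_contra! hc
        exact h4 ⟨⟨h1, h3⟩, hc⟩
      have hrC := frontier_sub hC h1
      have n1 := cap_plane_normal (C := C) he h5
      refine ⟨normal_frontier ⟨hrC, h2⟩ n1, fun hreg => ?_⟩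
      have n2 : IsOutwardNormalAt K r (normalMap C r) :=
        ⟨(normalMap_reg h3).1, fun x hx => (normalMap_reg h3).2 x hx.1⟩
      have heq := hreg.unique n1 n2
      have n3 := normal_interior_lt (normalMap_reg h3) hz
      rw [← heq, inner_neg_right] at n3
      have : z - r = (z - r₀) - (r - r₀) := by abel
      rw [this, inner_sub_left, hzt, h5] at n3
      linarith
    exact (ae_eq_set.2 ⟨hdiff, by rw [sdiff_eq_empty.2 hsub1, measure_empty]⟩)
  -- step 2
  have hplane : ∀ r ∈ RegS K \ H, normalMap K r = -e ∧ r ∈ Bset C r₀ e t := by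
    rintro r ⟨⟨h1, h2⟩, h3⟩
    obtain ⟨hrC, hrt⟩ := frontier_sub hK h1
    have h5 : ⟪r - r₀, e⟫ = -t := le_antisymm (not_lt.1 h3) hrt
    exact ⟨normalMap_unique h2 (cap_plane_normal he h5), hrC, h5⟩
  have hBm : μH[2] (RegS K \ H) = μH[2] (Bset C r₀ e t) := by
    apply le_antisymm
    · exact measure_mono fun r hr => (hplane r hr).2
    · have hsub : Bset C r₀ e t ⊆ (RegS K \ H) ∪ IrrS K := by
        rintro r ⟨hr, hrt⟩
        have hrt : ⟪r - r₀, e⟫ = -t := hrt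
        have hf : r ∈ frontier K := normal_frontier ⟨hr, hrt.ge⟩ (cap_plane_normal he hrt)
        by_cases h : IsRegularPt K r
        · exact Or.inl ⟨⟨hf, h⟩, fun hH => (ne_of_gt (show -t < ⟪r - r₀, e⟫ from hH)) hrt⟩
        · exact Or.inr ⟨hf, h⟩
      refine ((measure_mono hsub).trans (measure_union_le _ _)).trans ?_
      rw [irr_null hK, add_zero]
  have hflux := flux_zero hK
  rw [← integral_inter_add_sdiff hHm (normal_integrable hK)] at hflux
  have h2 : ∫ r in RegS K \ H, normalMap K r ∂μH[2] = -((μH[2] (Bset C r₀ e t)).toReal • e) := by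
    rw [setIntegral_congr_fun (g := fun _ => -e) ((measurable_reg hK).diff hHm)
      (fun r hr => (hplane r hr).1), setIntegral_const, Measure.real, hBm, smul_neg]
  have h1 : ∫ r in RegS C ∩ H, normalMap C r ∂μH[2] = ∫ r in RegS K ∩ H, normalMap K r ∂μH[2] := by
    rw [hregeq]
    exact setIntegral_congr_fun ((measurable_reg hC).inter hHm) hnormeq
  rw [hS, h1]
  rw [h2] at hflux
  exact add_neg_eq_zero.1 hflux

lemma ridge_le {C : Set E3} {r₀ e₁ e₂ e : E3} {lam₁ lam₂ : ℝ}
    (hcone : tanCone C r₀ = dihedral e₁ e₂)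
    (hl₁ : 0 < lam₁) (hl₂ : 0 < lam₂) (he : e = lam₁ • e₁ + lam₂ • e₂) (hnorm : ‖e‖ = 1) :
    IsOutwardNormalAt C r₀ e := by
  refine ⟨hnorm, fun x hx => ?_⟩
  have h1 : x - r₀ ∈ tanCone C r₀ := subset_closure ⟨1, x, hx, zero_le_one, (one_smul _ _).symm⟩
  rw [hcone] at h1
  obtain ⟨h2, h3⟩ := h1
  rw [he, inner_add_right, real_inner_smul_right, real_inner_smul_right]
  nlinarith

lemma exists_level {C : Set E3} (hC : IsConvexBody C) {r₀ e : E3} (hr₀ : r₀ ∈ frontier C)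
    (hn : IsOutwardNormalAt C r₀ e) :
    ∃ T : ℝ, 0 < T ∧ ∀ t, 0 < t → t < T → ∃ z ∈ interior C, ⟪z - r₀, e⟫ = -t := by
  obtain ⟨p, hp⟩ := hC.2.2
  have h := normal_interior_lt hn hp
  refine ⟨-⟪p - r₀, e⟫, by linarith, fun t ht htT => ?_⟩
  set T := -⟪p - r₀, e⟫ with hT
  have hTpos : 0 < T := by linarith
  refine ⟨r₀ + (t / T) • (p - r₀), ?_, ?_⟩
  · apply hC.2.1.openSegment_self_interior_subset_interior (frontier_sub hC hr₀) hp
    refine ⟨1 - t / T, t / T, ?_, by positivity, by ring, ?_⟩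
    · rw [sub_pos, div_lt_one hTpos]; exact htT
    · rw [smul_sub, sub_smul, one_smul]; abel
  · rw [add_sub_cancel_left, real_inner_smul_left]
    have : ⟪p - r₀, e⟫ = -T := by rw [hT, neg_neg]
    rw [this]; field_simp

lemma nu_integral {C : Set E3} (hC : IsConvexBody C) {r₀ e : E3} {t : ℝ}
    (f : BoundedContinuousFunction E3 ℝ) :
    ∫ x, f x ∂(nuT C r₀ e t) = ((μH[2] (Bset C r₀ e t))⁻¹).toReal *
      ∫ r in Sset C r₀ e t ∩ {r | IsRegularPt C r}, f (normalMap C r) ∂μH[2] := by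
  unfold nuT
  rw [integral_smul_measure, integral_map]
  · rfl
  · refine (aemeas_normal hC).mono_measure (Measure.restrict_mono ?_ le_rfl)
    rintro r ⟨⟨h1, _⟩, h2⟩
    exact ⟨h1, h2⟩
  · exact f.continuous.aestronglyMeasurable

lemma S_meas {C : Set E3} (hC : IsConvexBody C) (r₀ e : E3) (t : ℝ) :
    MeasurableSet (Sset C r₀ e t ∩ {r | IsRegularPt C r}) := by
  have : Sset C r₀ e t ∩ {r | IsRegularPt C r} = RegS C ∩ {r : E3 | ⟪r - r₀, e⟫ ≥ -t} := by
    ext r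
    constructor
    · rintro ⟨⟨h1, h3⟩, h2⟩; exact ⟨⟨h1, h2⟩, h3⟩
    · rintro ⟨⟨h1, h2⟩, h3⟩; exact ⟨⟨h1, h3⟩, h2⟩
  rw [this]
  exact (measurable_reg hC).inter
    (isClosed_le (by fun_prop) (by fun_prop) : IsClosed {r : E3 | -t ≤ ⟪r - r₀, e⟫}).measurableSet

/-- Truncated linear functional. -/
def clampF (u : E3) : BoundedContinuousFunction E3 ℝ :=
  BoundedContinuousFunction.ofNormedAddCommGroup (fun x => max (-1) (min 1 ⟪u, x⟫))
    (by fun_prop) 1 (by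
      intro x
      rw [Real.norm_eq_abs, abs_le]
      exact ⟨le_max_left _ _, max_le (by norm_num) (min_le_left _ _)⟩)

/-- Truncated distance to the unit sphere. -/
def sphF : BoundedContinuousFunction E3 ℝ :=
  BoundedContinuousFunction.ofNormedAddCommGroup (fun x => min 1 |‖x‖ - 1|)
    (by fun_prop) 1 (by
      intro x
      rw [Real.norm_eq_abs, abs_of_nonneg (le_min zero_le_one (abs_nonneg _))]
      exact min_le_left _ _)

lemma clampF_apply {u x : E3} (hu : ‖u‖ = 1) (hx : ‖x‖ = 1) : clampF u x = ⟪u, x⟫ := by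
  have h := abs_real_inner_le_norm u x
  rw [hu, hx, mul_one, abs_le] at h
  show max (-1) (min 1 ⟪u, x⟫) = _
  rw [min_eq_right h.2, max_eq_right h.1]

lemma sphF_apply (x : E3) : sphF x = min 1 |‖x‖ - 1| := rfl

lemma nu_clamp {C : Set E3} (hC : IsConvexBody C) {r₀ e z : E3} {t : ℝ} (he : ‖e‖ = 1)
    (hz : z ∈ interior C) (hzt : ⟪z - r₀, e⟫ = -t) {u : E3} (hu : ‖u‖ = 1) :
    ∫ x, clampF u x ∂(nuT C r₀ e t) = ⟪u, e⟫ := by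
  rw [nu_integral hC]
  have hsub : Sset C r₀ e t ∩ {r | IsRegularPt C r} ⊆ RegS C := by
    rintro r ⟨⟨h1, _⟩, h2⟩
    exact ⟨h1, h2⟩
  have h1 : ∫ r in Sset C r₀ e t ∩ {r | IsRegularPt C r}, clampF u (normalMap C r) ∂μH[2] =
      ∫ r in Sset C r₀ e t ∩ {r | IsRegularPt C r}, ⟪u, normalMap C r⟫ ∂μH[2] :=
    setIntegral_congr_fun (S_meas hC r₀ e t) fun r hr =>
      clampF_apply hu (normalMap_reg hr.2).1
  rw [h1, integral_inner ((normal_integrable hC).mono_set hsub), S_flux hC he hz hzt,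
    real_inner_smul_right, ENNReal.toReal_inv, ← mul_assoc, inv_mul_cancel₀, one_mul]
  exact (ENNReal.toReal_pos (B_pos he hz hzt).ne' (B_finite hC he hz hzt).ne).ne'

lemma nu_sph {C : Set E3} (hC : IsConvexBody C) {r₀ e : E3} {t : ℝ} :
    ∫ x, sphF x ∂(nuT C r₀ e t) = 0 := by
  rw [nu_integral hC]
  have h1 : ∫ r in Sset C r₀ e t ∩ {r | IsRegularPt C r}, sphF (normalMap C r) ∂μH[2] =
      ∫ r in Sset C r₀ e t ∩ {r | IsRegularPt C r}, (0 : ℝ) ∂μH[2] :=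
    setIntegral_congr_fun (S_meas hC r₀ e t) fun r hr => by
      simp [sphF_apply, (normalMap_reg hr.2).1]
  rw [h1]; simp

lemma nu_one {C : Set E3} (hC : IsConvexBody C) {r₀ e z : E3} {t : ℝ} (he : ‖e‖ = 1)
    (hz : z ∈ interior C) (hzt : ⟪z - r₀, e⟫ = -t) :
    1 ≤ ∫ x, BoundedContinuousFunction.const E3 (1 : ℝ) x ∂(nuT C r₀ e t) := by
  have h := nu_clamp hC he hz hzt he
  rw [real_inner_self_eq_norm_sq, he, one_pow] at h
  refine h.symm.le.trans ?_
  rw [nu_integral hC, nu_integral hC]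
  apply mul_le_mul_of_nonneg_left _ ENNReal.toReal_nonneg
  have hsub : Sset C r₀ e t ∩ {r | IsRegularPt C r} ⊆ RegS C := by
    rintro r ⟨⟨h1, _⟩, h2⟩
    exact ⟨h1, h2⟩
  have hfin : IsFiniteMeasure (μH[2].restrict (Sset C r₀ e t ∩ {r | IsRegularPt C r}) : Measure E3) :=
    ⟨by rw [Measure.restrict_apply_univ]; exact (measure_mono hsub).trans_lt (reg_finite hC)⟩
  have hm : AEMeasurable (normalMap C)
      (μH[2].restrict (Sset C r₀ e t ∩ {r | IsRegularPt C r})) :=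
    (aemeas_normal hC).mono_measure (Measure.restrict_mono hsub le_rfl)
  apply integral_mono
  · refine Integrable.of_bound
      ((clampF e).continuous.measurable.comp_aemeasurable hm).aestronglyMeasurable 1 ?_
    refine Eventually.of_forall fun r => ?_
    show ‖max (-1) (min 1 ⟪e, normalMap C r⟫)‖ ≤ 1
    rw [Real.norm_eq_abs, abs_le]
    exact ⟨le_max_left _ _, max_le (by norm_num) (min_le_left _ _)⟩
  · exact integrable_const (1 : ℝ)
  · intro r
    show max (-1) (min 1 ⟪e, normalMap C r⟫) ≤ 1
    exact max_le (by norm_num) (min_le_left _ _)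


/-- **Formula (5) of the paper.** Every partial weak limit `ν_*` of `ν_t` as `t → 0⁺`
satisfies `∫_{S²} n dν_*(n) = e`. -/
theorem partial_weak_limit_first_moment_eq
    (C : Set E3) (r₀ e₁ e₂ e : E3) (lam₁ lam₂ : ℝ)
    (hC : IsConvexBody C) (hr₀ : r₀ ∈ frontier C)
    (he₁ : ‖e₁‖ = 1) (he₂ : ‖e₂‖ = 1) (hne : e₁ ≠ e₂) (hne' : e₁ ≠ -e₂)
    (hcone : tanCone C r₀ = dihedral e₁ e₂)
    (hl₁ : 0 < lam₁) (hl₂ : 0 < lam₂) (he : e = lam₁ • e₁ + lam₂ • e₂) (hnorm : ‖e‖ = 1) :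
    ∀ ν₀ : Measure E3, IsPartialWeakLimit (nuT C r₀ e) ν₀ →
      ∫ n, n ∂ν₀ = e := by
  rintro ν₀ ⟨ts, hpos, hts, hlim⟩
  obtain ⟨T, hT, hlev⟩ := exists_level hC hr₀ (ridge_le hcone hl₁ hl₂ he hnorm)
  have hev : ∀ᶠ i in atTop, ∃ z ∈ interior C, ⟪z - r₀, e⟫ = -ts i := by
    filter_upwards [hts.eventually (gt_mem_nhds hT)] with i hi
    exact hlev _ (hpos i) hi
  have hcl : ∀ u : E3, ‖u‖ = 1 → ∫ x, clampF u x ∂ν₀ = ⟪u, e⟫ := by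
    intro u hu
    refine tendsto_nhds_unique (hlim (clampF u)) (tendsto_const_nhds.congr' ?_)
    filter_upwards [hev] with i ⟨z, hz, hzt⟩
    exact (nu_clamp hC hnorm hz hzt hu).symm
  have hsph : ∫ x, sphF x ∂ν₀ = 0 := by
    refine tendsto_nhds_unique (hlim sphF) (tendsto_const_nhds.congr' ?_)
    exact Eventually.of_forall fun i => (nu_sph hC).symm
  have hone : 1 ≤ ∫ x, BoundedContinuousFunction.const E3 (1 : ℝ) x ∂ν₀ := by
    refine ge_of_tendsto (hlim _) ?_
    filter_upwards [hev] with i ⟨z, hz, hzt⟩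
    exact nu_one hC hnorm hz hzt
  have hfin : IsFiniteMeasure ν₀ := by
    have hi : Integrable (fun _ : E3 => (1 : ℝ)) ν₀ := by
      by_contra hni
      have h0 : ∫ x, BoundedContinuousFunction.const E3 (1 : ℝ) x ∂ν₀ = 0 := integral_undef hni
      linarith
    rcases integrable_const_iff.1 hi with h | h
    · norm_num at h
    · exact h
  have hae : ∀ᵐ x ∂ν₀, ‖x‖ = 1 := by
    have h0 : 0 ≤ (fun x => sphF x) := fun x => le_min zero_le_one (abs_nonneg _)
    have h1 := (integral_eq_zero_iff_of_nonneg h0 (sphF.integrable ν₀)).1 hsph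
    filter_upwards [h1] with x hx
    have hx' : min 1 |‖x‖ - 1| = 0 := hx
    rcases min_choice 1 |‖x‖ - 1| with h | h
    · rw [h] at hx'; norm_num at hx'
    · rw [h, abs_eq_zero] at hx'; linarith
  have hInt : Integrable (fun n : E3 => n) ν₀ :=
    Integrable.of_bound aestronglyMeasurable_id 1 (by
      filter_upwards [hae] with x hx
      exact hx.le)
  have hin : ∀ u : E3, ‖u‖ = 1 → ⟪u, ∫ n, n ∂ν₀⟫ = ⟪u, e⟫ := by
    intro u hu
    rw [← integral_inner hInt u, ← hcl u hu]
    refine integral_congr_ae ?_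
    filter_upwards [hae] with x hx
    exact (clampF_apply hu hx).symm
  by_contra hneq
  set v := (∫ n, n ∂ν₀) - e with hv
  have hv0 : v ≠ 0 := sub_ne_zero.2 hneq
  have h1 := hin (‖v‖⁻¹ • v) (by
    rw [norm_smul, norm_inv, norm_norm, inv_mul_cancel₀ (norm_ne_zero_iff.2 hv0)])
  have h2 : ⟪‖v‖⁻¹ • v, v⟫ = 0 := by
    conv_lhs => rw [hv, inner_sub_right]
    rw [← hv, h1, sub_self]
  rw [real_inner_smul_left, real_inner_self_eq_norm_sq] at h2
  have : 0 < ‖v‖ := norm_pos_iff.2 hv0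
  have : 0 < ‖v‖⁻¹ * ‖v‖ ^ 2 := by positivity
  linarith
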